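/- Let b, d, s be natural numbers and X₁, X₂ natural numbers such that s ≤ d and sin X₁ < sin X₂. Then there exist natural numbers e₁, e₂, Y such that: (i) sin X₁ < sin Y < sin X₂; (ii) d < e₁ < e₂ and Y ≤ e₂; (iii) Next(b, e₁) holds; (iv) for all natural numbers Z, if Y is the best approximate of Z up to e₂ (Z|_{e₂} = Y), then Best(d, e₁, X₁, Z, s) holds. -/

import Mathlib

/-- `BestApp X d Y` says that `Y` is the best approximate of `X` up to `d`
(written `X|_d = Y`): `Y ≤ d`, `sin Y ≤ sin X`, and for every `Z ≤ d` with
`Z ≠ Y` and `sin Z ≤ sin X` one has `sin Z < sin Y`. -/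
def BestApp (X d Y : ℕ) : Prop :=
  Y ≤ d ∧ Real.sin Y ≤ Real.sin X ∧
    ∀ Z : ℕ, Z ≤ d → Z ≠ Y → Real.sin Z ≤ Real.sin X → Real.sin Z < Real.sin Y


/-- `Next X₁ X₂` holds iff `X₁ < X₂`, `sin X₁ < sin X₂`, and for every `Z < X₂`
either `sin Z ≤ sin X₁` or `sin X₂ < sin Z`. -/
def Next (X₁ X₂ : ℕ) : Prop :=
  X₁ < X₂ ∧ Real.sin X₁ < Real.sin X₂ ∧
    ∀ Z : ℕ, Z < X₂ → Real.sin Z ≤ Real.sin X₁ ∨ Real.sin X₂ < Real.sin Z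

/-- `g (X₁, X₂, Y₁, Y₂) = |sin X₂ − sin X₁ − |sin Y₂ − sin Y₁||`. -/
noncomputable def gFn (X₁ X₂ Y₁ Y₂ : ℕ) : ℝ :=
  abs (Real.sin X₂ - Real.sin X₁ - abs (Real.sin Y₂ - Real.sin Y₁))

/-- `Best d e X₁ X₂ Y₁` holds iff there is `Y₂` with `Y₁ ≤ d`, `Y₂ ≤ e`,
`Y₁ < Y₂`, and `g (X₁, X₂, Y₁, Y₂) < g (X₁, X₂, Z₁, Z₂)` for all `Z₁ ≤ d`,
`Z₂ ≤ e` with `{Z₁, Z₂} ≠ {Y₁, Y₂}` as sets. -/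
def Best (d e X₁ X₂ Y₁ : ℕ) : Prop :=
  ∃ Y₂ : ℕ, Y₁ ≤ d ∧ Y₂ ≤ e ∧ Y₁ < Y₂ ∧
    ∀ Z₁ Z₂ : ℕ, Z₁ ≤ d → Z₂ ≤ e → ({Z₁, Z₂} : Set ℕ) ≠ {Y₁, Y₂} →
      gFn X₁ X₂ Y₁ Y₂ < gFn X₁ X₂ Z₁ Z₂

open Polynomial in
theorem exists_int_re_aeval_I_mul (g : ℤ[X]) (k : ℤ) :
    ∃ m : ℤ, (aeval (Complex.I * k) g).re = m := by
  refine ⟨(aeval (⟨0, k⟩ : GaussianInt) g).re, ?_⟩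
  have h := aeval_algHom_apply GaussianInt.toComplex.toIntAlgHom (⟨0, k⟩ : GaussianInt) g
  have h' : GaussianInt.toComplex.toIntAlgHom (⟨0, k⟩ : GaussianInt) = Complex.I * k := by
    simp [GaussianInt.toComplex_def, mul_comm]
  rw [h'] at h
  rw [h]
  exact (GaussianInt.intCast_re _).symm

open Polynomial in
theorem transcendental_exp_I : Transcendental ℤ (Complex.exp Complex.I) := by
  intro h
  obtain ⟨P, hP0, hP⟩ := h.exists_nonzero_coeff_and_aeval_eq_zero
    (mem_nonZeroDivisors_of_ne_zero (Complex.exp_ne_zero _))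
  set N := P.natDegree
  set a : ℕ → ℤ := fun k ↦ P.coeff (k + 1)
  let f : ℤ[X] := ∏ k ∈ Finset.range N, (X ^ 2 + C ((k + 1 : ℤ) ^ 2))
  have hf0 : f.eval 0 ≠ 0 := by
    simp only [f, eval_prod, Finset.prod_ne_zero_iff]
    intro k _
    simp
    positivity
  have hroot : ∀ k < N, Complex.I * ((k + 1 : ℤ) : ℂ) ∈ f.aroots ℂ := by
    intro k hk
    rw [mem_aroots]
    refine ⟨fun h ↦ hf0 (by simp [h]), ?_⟩
    simp only [f, map_prod]
    refine Finset.prod_eq_zero (Finset.mem_range.2 hk) ?_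
    simp [mul_pow]
  obtain ⟨c, hc⟩ := LindemannWeierstrass.exp_polynomial_approx f hf0
  have hsum : (P.coeff 0 : ℂ) +
      ∑ k ∈ Finset.range N, (a k : ℂ) * Complex.exp (Complex.I * ((k + 1 : ℤ) : ℂ)) = 0 := by
    rw [aeval_eq_sum_range, Finset.sum_range_succ'] at hP
    rw [← hP, add_comm]
    congr 1
    · refine Finset.sum_congr rfl fun k _ ↦ ?_
      rw [← Complex.exp_nat_mul, zsmul_eq_mul]
      simp [a, mul_comm]
    · simp
  set A : ℝ := ∑ k ∈ Finset.range N, |(a k : ℝ)|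
  have hlim : Filter.Tendsto (fun p : ℕ ↦ A * (c * (c ^ p / (p.factorial : ℝ)))) Filter.atTop
      (nhds 0) := by
    simpa using ((FloorSemiring.tendsto_pow_div_factorial_atTop c).const_mul c).const_mul A
  obtain ⟨p₀, hp₀⟩ := Filter.eventually_atTop.1 (hlim.eventually_lt_const one_pos)
  obtain ⟨p, hpge, hp⟩ := Nat.exists_infinite_primes
    (p₀ + (eval 0 f).natAbs + (P.coeff 0).natAbs + 2)
  obtain ⟨n, hn, g, -, hg⟩ := hc p (by omega) hp
  choose m hm using fun k : ℕ ↦ exists_int_re_aeval_I_mul g (k + 1)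
  set r : ℕ → ℂ := fun k ↦ Complex.I * ((k + 1 : ℤ) : ℂ)
  have hbound : ‖∑ k ∈ Finset.range N, (a k : ℂ) * (n • Complex.exp (r k) - p • aeval (r k) g)‖
      < 1 := by
    have h1 := hp₀ (p - 1) (by omega)
    rw [← mul_div_assoc, ← pow_succ', Nat.sub_add_cancel hp.one_le] at h1
    refine lt_of_le_of_lt (norm_sum_le _ _) (lt_of_le_of_lt ?_ h1)
    rw [Finset.sum_mul]
    refine Finset.sum_le_sum fun k hk ↦ ?_
    rw [norm_mul, Complex.norm_intCast]
    exact mul_le_mul_of_nonneg_left (hg (hroot k (Finset.mem_range.1 hk))) (abs_nonneg _)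
  have heq : ∑ k ∈ Finset.range N, (a k : ℂ) * (n • Complex.exp (r k) - p • aeval (r k) g)
      = -(n * P.coeff 0 : ℂ) - p * ∑ k ∈ Finset.range N, (a k : ℂ) * aeval (r k) g := by
    rw [eq_neg_of_add_eq_zero_left hsum, Finset.mul_sum, mul_neg, neg_neg, Finset.mul_sum,
      ← Finset.sum_sub_distrib]
    refine Finset.sum_congr rfl fun k _ ↦ ?_
    rw [zsmul_eq_mul, nsmul_eq_mul]
    ring
  have hre : (∑ k ∈ Finset.range N,
      (a k : ℂ) * (n • Complex.exp (r k) - p • aeval (r k) g)).re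
      = ((-(n * P.coeff 0) - p * ∑ k ∈ Finset.range N, a k * m k : ℤ) : ℝ) := by
    rw [heq]
    have : (∑ k ∈ Finset.range N, (a k : ℂ) * aeval (r k) g).re
        = ((∑ k ∈ Finset.range N, a k * m k : ℤ) : ℝ) := by
      rw [Complex.re_sum]
      push_cast
      refine Finset.sum_congr rfl fun k _ ↦ ?_
      rw [← hm k]
      simp [r]
    rw [Complex.sub_re, ← Complex.ofReal_natCast, Complex.re_ofReal_mul, this]
    push_cast
    simp
  have hzero : -(n * P.coeff 0) - p * ∑ k ∈ Finset.range N, a k * m k = 0 := by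
    rw [← Int.abs_lt_one_iff]
    have := (Complex.abs_re_le_norm _).trans_lt hbound
    rw [hre] at this
    exact_mod_cast this
  have hdvd : (p : ℤ) ∣ n * P.coeff 0 :=
    ⟨-∑ k ∈ Finset.range N, a k * m k, by linarith⟩
  rcases (Nat.prime_iff_prime_int.1 hp).dvd_or_dvd hdvd with h | h
  · exact hn h
  · have := Int.natAbs_le_of_dvd_ne_zero h hP0
    simp at this
    omega

open Polynomial in
theorem sin_sub_sin_eq_cases {a b c d : ℕ} (hcd : c < d) {ε : ℤ} (hε : ε = 1 ∨ ε = -1)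
    (h : Real.sin a - Real.sin b = ε * (Real.sin d - Real.sin c)) :
    a = c ∧ b = d ∨ a = d ∧ b = c := by
  set z := Complex.exp Complex.I
  have hz : z ≠ 0 := Complex.exp_ne_zero _
  let M := a + b + c + d
  let S : ℕ → ℤ[X] := fun k ↦ X ^ (M + k) - X ^ (M - k)
  have hS : ∀ k ≤ M, aeval z (S k) = 2 * Complex.I * z ^ M * (Real.sin k : ℂ) := by
    intro k hk
    have h1 : z ^ M * Complex.exp (-(k * Complex.I)) = z ^ (M - k) := by
      rw [Complex.exp_neg, Complex.exp_nat_mul, pow_sub₀ _ hz hk]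
    have h2 : Complex.exp (k * Complex.I) = z ^ k := Complex.exp_nat_mul _ _
    simp only [S, map_sub, map_pow, aeval_X, Complex.ofReal_sin, Complex.ofReal_natCast,
      Complex.sin, neg_mul]
    rw [← h1, h2, pow_add]
    linear_combination (z ^ M * z ^ k - z ^ M * Complex.exp (-(k * Complex.I))) * Complex.I_sq
  have hP : S a - S b - C ε * (S d - S c) = 0 := by
    refine transcendental_iff.1 transcendental_exp_I _ ?_
    have h' : (Real.sin a : ℂ) - Real.sin b = ε * (Real.sin d - Real.sin c) := by exact_mod_cast h
    change aeval z _ = 0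
    simp only [map_sub, map_mul, aeval_C]
    rw [hS a (by omega), hS b (by omega), hS c (by omega), hS d (by omega)]
    simp only [algebraMap_int_eq, eq_intCast]
    linear_combination 2 * Complex.I * z ^ M * h'
  have hcoeff : ∀ k, 0 < k → ((if k = a then 1 else 0) - (if k = b then 1 else 0) : ℤ)
      = ε * ((if k = d then 1 else 0) - (if k = c then 1 else 0)) := by
    intro k hk
    have hSk : ∀ j, (S j).coeff (M + k) = if k = j then 1 else 0 := by
      intro j
      have : M + k ≠ M - j := by omega
      simp [S, coeff_X_pow, this]
    have := congrArg (coeff · (M + k)) hP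
    simp only [coeff_sub, coeff_C_mul, hSk, coeff_zero] at this
    linarith
  have hd := hcoeff d (by omega)
  have hc := hcoeff c
  have ha := hcoeff a
  have hb := hcoeff b
  clear hcoeff hP hS
  rcases hε with rfl | rfl <;> grind

theorem frequently_sin_natCast_mem_Ioo {a b : ℝ} (hab : a < b) (ha : a < 1) (hb : -1 < b) :
    ∃ᶠ n : ℕ in Filter.atTop, Real.sin n ∈ Set.Ioo a b := by
  have : Fact (0 < 2 * Real.pi) := ⟨Real.two_pi_pos⟩
  have : CompactSpace Real.Angle := inferInstanceAs (CompactSpace (AddCircle (2 * Real.pi)))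
  have hirr : Irrational (1 / (2 * Real.pi)) := by
    simpa using! (irrational_pi.natCast_mul two_ne_zero).inv
  have hdense := AddCircle.denseRange_zsmul_coe_iff.2 hirr
  obtain ⟨y, hy₁, hy₂⟩ := exists_between
    (max_lt (lt_min hab ha) (lt_min hb (by norm_num : (-1 : ℝ) < 1)))
  have hsin : Real.sin (Real.arcsin y) = y :=
    Real.sin_arcsin ((le_max_right _ _).trans hy₁.le) (hy₂.le.trans (min_le_right _ _))
  have hmem := (mapClusterPt_atTop_nsmul_iff_mem_topologicalClosure_zmultiples
    (x := (Real.arcsin y : Real.Angle)) (y := ((1 : ℝ) : Real.Angle))).2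
    (hdense (Real.arcsin y : Real.Angle))
  have hnhds : Real.Angle.sin ⁻¹' Set.Ioo a b ∈ nhds (Real.arcsin y : Real.Angle) := by
    refine Real.Angle.continuous_sin.continuousAt.preimage_mem_nhds (isOpen_Ioo.mem_nhds ?_)
    rw [Real.Angle.sin_coe, hsin]
    exact ⟨(le_max_left _ _).trans_lt hy₁, hy₂.trans_le (min_le_left _ _)⟩
  refine (mapClusterPt_iff_frequently.1 hmem _ hnhds).mono fun n hn ↦ ?_
  rw [Set.mem_preimage, ← Real.Angle.coe_nsmul, Real.Angle.sin_coe] at hn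
  simpa using hn

theorem sin_natCast_lt_one (n : ℕ) : Real.sin n < 1 := by
  refine lt_of_le_of_ne (Real.sin_le_one _) fun h ↦ ?_
  obtain ⟨k, hk⟩ := Real.sin_eq_one_iff.1 h
  have hk0 : (1 + 4 * k : ℤ) ≠ 0 := by omega
  have hirr := irrational_pi.intCast_mul hk0
  refine (hirr.ne_nat (2 * n)) ?_
  push_cast
  linarith

theorem exists_next_gt (b m : ℕ) : ∃ e, m < e ∧ Next b e := by
  have hev : ∀ᶠ t in nhdsWithin (Real.sin b) (Set.Ioi (Real.sin b)),
      ∀ k ∈ Finset.range (max m b + 1), Real.sin b < Real.sin k → t < Real.sin k := by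
    rw [Filter.eventually_all_finset]
    intro k _
    by_cases h : Real.sin b < Real.sin k
    · filter_upwards [nhdsWithin_le_nhds (eventually_lt_nhds h)] with t ht _ using ht
    · simp [h]
  obtain ⟨t, ht, hbt⟩ := (hev.and self_mem_nhdsWithin).exists
  have hex := (frequently_sin_natCast_mem_Ioo hbt (sin_natCast_lt_one b)
    ((Real.neg_one_le_sin b).trans_lt hbt)).exists
  classical
  obtain ⟨hb, hlt⟩ := Nat.find_spec hex
  have hgt : max m b < Nat.find hex := by
    by_contra! hle
    exact (ht _ (Finset.mem_range.2 (by omega)) hb).not_gt hlt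
  refine ⟨Nat.find hex, by omega, by omega, hb, fun Z hZ ↦ ?_⟩
  have := Nat.find_min hex hZ
  by_contra! hcon
  exact this ⟨hcon.1, hcon.2.trans_lt hlt⟩

theorem abs_sin_sub_sin_ne {s Y Z₁ Z₂ : ℕ} (hsY : s < Y)
    (hne : ({Z₁, Z₂} : Set ℕ) ≠ {s, Y}) :
    |Real.sin Z₂ - Real.sin Z₁| ≠ |Real.sin Y - Real.sin s| := by
  intro h
  have : ∃ ε : ℤ, (ε = 1 ∨ ε = -1) ∧
      Real.sin Z₂ - Real.sin Z₁ = ε * (Real.sin Y - Real.sin s) := by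
    rcases abs_eq_abs.1 h with h | h
    · exact ⟨1, by simp, by simpa using h⟩
    · exact ⟨-1, by simp, by simpa using h⟩
  obtain ⟨ε, hε, h⟩ := this
  rcases sin_sub_sin_eq_cases hsY hε h with ⟨rfl, rfl⟩ | ⟨rfl, rfl⟩
  · exact hne (Set.pair_comm _ _)
  · exact hne rfl

theorem exists_best_of_abs_sub_lt {d e s Y : ℕ} (X₁ : ℕ)
    (hsd : s ≤ d) (hsY : s < Y) (hYe : Y ≤ e) :
    ∃ η > 0, ∀ Z : ℕ, |Real.sin Z - (Real.sin X₁ + |Real.sin Y - Real.sin s|)| < η →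
      Best d e X₁ Z s := by
  have hev : ∀ᶠ t : ℝ in nhdsWithin 0 (Set.Ioi 0), ∀ p ∈ Finset.Iic d ×ˢ Finset.Iic e,
      ({p.1, p.2} : Set ℕ) ≠ {s, Y} →
        t < |(|Real.sin p.2 - Real.sin p.1| - |Real.sin Y - Real.sin s|)| := by
    rw [Filter.eventually_all_finset]
    intro p _
    by_cases h : ({p.1, p.2} : Set ℕ) = {s, Y}
    · simp [h]
    · have hpos := abs_pos.2 (sub_ne_zero.2 (abs_sin_sub_sin_ne hsY h))
      filter_upwards [nhdsWithin_le_nhds (eventually_lt_nhds hpos)] with t ht _ using ht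
  obtain ⟨t, ht, htpos⟩ := (hev.and self_mem_nhdsWithin).exists
  refine ⟨t / 2, half_pos htpos, fun Z hZ ↦ ⟨Y, hsd, hYe, hsY, fun Z₁ Z₂ h₁ h₂ hne ↦ ?_⟩⟩
  have hfar := ht (Z₁, Z₂) (by simp [h₁, h₂]) hne
  have htri := abs_sub_le |Real.sin Z₂ - Real.sin Z₁| (Real.sin Z - Real.sin X₁)
    |Real.sin Y - Real.sin s|
  rw [abs_sub_comm |Real.sin Z₂ - Real.sin Z₁| (Real.sin Z - Real.sin X₁)] at htri
  rw [← sub_sub] at hZ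
  unfold gFn
  linarith

/-- **Lemma 3.13.** Let `b, d, s` be naturals and `X₁, X₂` naturals with
`s ≤ d` and `sin X₁ < sin X₂`.  Then there exist `e₁, e₂, Y` such that:
(i) `sin X₁ < sin Y < sin X₂`; (ii) `d < e₁ < e₂` and `Y ≤ e₂`;
(iii) `Next b e₁`; (iv) every `Z` with `Z|_{e₂} = Y` satisfies
`Best d e₁ X₁ Z s`. -/
theorem exists_bestApp_target (b d s X₁ X₂ : ℕ)
    (hsd : s ≤ d) (hsin : Real.sin X₁ < Real.sin X₂) :
    ∃ e₁ e₂ Y : ℕ,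
      (Real.sin X₁ < Real.sin Y ∧ Real.sin Y < Real.sin X₂) ∧
      (d < e₁ ∧ e₁ < e₂ ∧ Y ≤ e₂) ∧
      Next b e₁ ∧
      ∀ Z : ℕ, BestApp Z e₂ Y → Best d e₁ X₁ Z s := by
  set ε := Real.sin X₂ - Real.sin X₁
  have hε : 0 < ε := sub_pos.2 hsin
  obtain ⟨V, ⟨hV₁, hV₂⟩, hsV⟩ := ((frequently_sin_natCast_mem_Ioo
    (a := Real.sin s - ε) (b := Real.sin s + ε) (by linarith)
    (by linarith [Real.sin_le_one s]) (by linarith [Real.neg_one_le_sin s])).and_eventually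
    (Filter.eventually_gt_atTop s)).exists
  obtain ⟨e₁, he₁, hnext⟩ := exists_next_gt b (max d V)
  obtain ⟨η, hη, hbest⟩ := exists_best_of_abs_sub_lt X₁ hsd hsV
    (show V ≤ e₁ by omega)
  set δ := |Real.sin V - Real.sin s|
  have hδε : δ < ε := abs_lt.2 ⟨by linarith, by linarith⟩
  have hδ : 0 < δ := by
    refine (abs_nonneg _).lt_of_ne fun h ↦ ?_
    refine abs_sin_sub_sin_ne (Z₁ := s) (Z₂ := s) hsV ?_ (by simpa [δ] using h)
    intro hset
    have : V ∈ ({s, s} : Set ℕ) := hset ▸ Set.mem_insert_of_mem _ rfl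
    simp at this
    omega
  have hlo := Real.neg_one_le_sin X₁
  have hhi := Real.sin_le_one X₂
  obtain ⟨Y, hY₁, hY₂⟩ := (frequently_sin_natCast_mem_Ioo
    (a := max (Real.sin X₁) (Real.sin X₁ + δ - η)) (b := Real.sin X₁ + δ)
    (max_lt (by linarith) (by linarith)) (max_lt (by linarith) (by linarith))
    (by linarith)).exists
  obtain ⟨W, hW₁, hW₂⟩ := (frequently_sin_natCast_mem_Ioo
    (a := Real.sin X₁ + δ) (b := Real.sin X₁ + δ + η)
    (by linarith) (by linarith) (by linarith)).exists
  rw [max_lt_iff] at hY₁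
  refine ⟨e₁, max e₁ (max Y W) + 1, Y, ⟨hY₁.1, by linarith⟩, ⟨by omega, by omega, by omega⟩, hnext,
    fun Z hZ ↦ hbest Z ?_⟩
  obtain ⟨-, hYZ, hZ⟩ := hZ
  have hZW : Real.sin Z < Real.sin W := by
    by_contra! hle
    have hWY : W ≠ Y := by rintro rfl; linarith
    linarith [hZ W (by omega) hWY hle]
  exact abs_lt.2 ⟨by linarith, by linarith⟩
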